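/- (Corollary 1.) Assume (A0). Let $(a,\rho)$ be the solution of the Friedmann system with initial data $a(0)=a_0>0$, $a'(0)=\dot a_0$, $\rho(0)=\rho_0>0$, on its maximal interval of existence $]t_-,t_+[$ in $\{a>0,\ \rho>0\}$. If $\dot a_0>0$ and $\big(\tfrac{8\pi G}{3}\rho_0+\tfrac{c^2\Lambda}{3}\big)a_0^2\le\dot a_0^2$ (i.e. $K\le 0$), then $t_-$ is finite, and $a(t)\to 0$ and $\rho(t)\to+\infty$ as $t\to t_-+0$. -/

import Mathlib

open Real Filter Set Topology

/-- Assumption (A0): `P` is a smooth function of `ρ > 0` with `0 ≤ P`,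
`0 ≤ dP/dρ < c²` for `ρ > 0`, and `P → 0` as `ρ → 0⁺`. -/
def A0 (c : ℝ) (P : ℝ → ℝ) : Prop :=
  ContDiffOn ℝ (⊤ : ℕ∞) P (Set.Ioi 0) ∧
  (∀ ρ > (0 : ℝ), 0 ≤ P ρ) ∧
  (∀ ρ > (0 : ℝ), 0 ≤ deriv P ρ ∧ deriv P ρ < c ^ 2) ∧
  Filter.Tendsto P (nhdsWithin 0 (Set.Ioi 0)) (nhds 0)

/-- A solution of the Friedmann system on a set `I`: `a > 0`, `ρ > 0`,
`a'' = (-(4πG/3)(ρ + 3P(ρ)/c²) + c²Λ/3) a` and `ρ' = -3(ρ + P(ρ)/c²) a'/a`. -/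
def IsFriedmannSolution (c G Λ : ℝ) (P : ℝ → ℝ) (a ρ : ℝ → ℝ) (I : Set ℝ) : Prop :=
  ∀ t ∈ I, 0 < a t ∧ 0 < ρ t ∧
    DifferentiableAt ℝ a t ∧
    HasDerivAt (deriv a)
      ((-(4 * Real.pi * G / 3) * (ρ t + 3 * P (ρ t) / c ^ 2) + c ^ 2 * Λ / 3) * a t) t ∧
    HasDerivAt ρ (-3 * (ρ t + P (ρ t) / c ^ 2) * (deriv a t / a t)) t

/-- `(a, ρ)` is a solution of the Friedmann system on the maximal interval of existence
`]t₋, t₊[` (with `-∞ ≤ t₋ < 0 < t₊ ≤ +∞`) in the domain `{a > 0, ρ > 0}`: the solution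
property holds on `]t₋, t₊[`, and any solution with the same initial data at `t = 0`
is defined on a subinterval of `]t₋, t₊[`. -/
def IsMaximalSolution (c G Λ : ℝ) (P : ℝ → ℝ) (a ρ : ℝ → ℝ) (tm tp : EReal) : Prop :=
  tm < (0 : EReal) ∧ (0 : EReal) < tp ∧
  IsFriedmannSolution c G Λ P a ρ {t : ℝ | tm < (t : EReal) ∧ (t : EReal) < tp} ∧
  ∀ (b σ : ℝ → ℝ) (s u : ℝ), s < 0 → 0 < u →
    IsFriedmannSolution c G Λ P b σ (Set.Ioo s u) →
    b 0 = a 0 → deriv b 0 = deriv a 0 → σ 0 = ρ 0 →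
    tm ≤ (s : EReal) ∧ (u : EReal) ≤ tp

/-- Gluing two differentiable functions whose values and derivatives match at `T`. -/
lemma hasDerivAt_ite_le {f g f' g' : ℝ → ℝ} {s T u : ℝ}
    (hf : ∀ t ∈ Ioc s T, HasDerivAt f (f' t) t) (hg : ∀ t ∈ Ioo T u, HasDerivAt g (g' t) t)
    (hlim : Tendsto g (𝓝[>] T) (𝓝 (f T))) (hlim' : Tendsto g' (𝓝[>] T) (𝓝 (f' T)))
    (hTu : T < u) {t : ℝ} (ht : t ∈ Ioo s u) :
    HasDerivAt (fun t => if t ≤ T then f t else g t) (if t ≤ T then f' t else g' t) t := by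
  rcases lt_trichotomy t T with h | rfl | h
  · rw [if_pos h.le]
    refine (hf t ⟨ht.1, h.le⟩).congr_of_eventuallyEq ?_
    filter_upwards [Iio_mem_nhds h] with x hx using if_pos (le_of_lt hx)
  · rw [if_pos le_rfl]
    have hleft : HasDerivWithinAt (fun x => if x ≤ t then f x else g x) (f' t) (Iic t) t :=
      (hf t ⟨ht.1, le_rfl⟩).hasDerivWithinAt.congr (fun x hx => if_pos hx) (if_pos le_rfl)
    have hglue : ∀ x ∈ Ioo t u, HasDerivAt (fun x => if x ≤ t then f x else g x) (g' x) x := by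
      intro x hx
      refine (hg x hx).congr_of_eventuallyEq ?_
      filter_upwards [Ioi_mem_nhds hx.1] with y hy using if_neg (not_le.2 hy)
    have hright : HasDerivWithinAt (fun x => if x ≤ t then f x else g x) (f' t) (Ici t) t := by
      refine hasDerivWithinAt_Ici_of_tendsto_deriv (s := Ioo t u)
        (fun x hx => (hglue x hx).differentiableAt.differentiableWithinAt) ?_
        (Ioo_mem_nhdsGT hTu) ?_
      · have : Tendsto (fun x => if x ≤ t then f x else g x) (𝓝[Ioo t u] t) (𝓝 (f t)) := by
          refine (hlim.mono_left (nhdsWithin_mono t Ioo_subset_Ioi_self)).congr' ?_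
          filter_upwards [self_mem_nhdsWithin] with x hx using (if_neg (not_le.2 hx.1)).symm
        simpa [ContinuousWithinAt] using this
      · refine hlim'.congr' ?_
        filter_upwards [Ioo_mem_nhdsGT hTu] with x hx using (hglue x hx).deriv.symm
    have := hleft.union hright
    rwa [Iic_union_Ici, hasDerivWithinAt_univ] at this
  · rw [if_neg (not_le.2 h)]
    refine (hg t ⟨h, ht.2⟩).congr_of_eventuallyEq ?_
    filter_upwards [Ioi_mem_nhds h] with y hy using if_neg (not_le.2 hy)

/-- Under (A0) the pressure satisfies `P ρ ≤ c² ρ`. -/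
lemma A0.le_mul {c : ℝ} {P : ℝ → ℝ} (h : A0 c P) {r : ℝ} (hr : 0 < r) : P r ≤ c ^ 2 * r := by
  obtain ⟨hsm, -, hder, hlim⟩ := h
  have hd : ∀ x ∈ Ioi (0 : ℝ), HasDerivAt P (deriv P x) x := fun x hx =>
    ((hsm.contDiffAt (Ioi_mem_nhds hx)).differentiableAt (by simp)).hasDerivAt
  have hd' : ∀ x ∈ Ioi (0 : ℝ), HasDerivAt (fun x => P x - c ^ 2 * x) (deriv P x - c ^ 2) x :=
    fun x hx => ((hd x hx).sub ((hasDerivAt_id x).const_mul (c ^ 2))).congr_deriv (by simp)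
  have hanti : AntitoneOn (fun x => P x - c ^ 2 * x) (Ioi 0) := by
    refine antitoneOn_of_hasDerivWithinAt_nonpos (convex_Ioi 0)
      (fun x hx => (hd' x hx).continuousAt.continuousWithinAt) (f' := fun x => deriv P x - c ^ 2)
      (fun x hx => (hd' x (interior_subset hx)).hasDerivWithinAt) fun x hx => ?_
    have := (hder x (interior_subset hx)).2
    linarith
  have hlim0 : Tendsto (fun x => P x - c ^ 2 * x) (𝓝[>] 0) (𝓝 0) := by
    have : Tendsto (fun x : ℝ => c ^ 2 * x) (𝓝[>] 0) (𝓝 (c ^ 2 * 0)) :=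
      ((continuous_const.mul continuous_id).tendsto 0).mono_left nhdsWithin_le_nhds
    simpa using hlim.sub this
  have := ge_of_tendsto hlim0 (b := P r - c ^ 2 * r) (by
    filter_upwards [Ioo_mem_nhdsGT hr] with x hx using hanti hx.1 hr hx.2.le)
  linarith

lemma IsFriedmannSolution.mono {c G Λ : ℝ} {P a ρ : ℝ → ℝ} {I J : Set ℝ}
    (h : IsFriedmannSolution c G Λ P a ρ I) (hJ : J ⊆ I) : IsFriedmannSolution c G Λ P a ρ J :=
  fun t ht => h t (hJ ht)

section Expanding

variable {c G Λ : ℝ} {P a ρ : ℝ → ℝ} {D : Set ℝ}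

/-- The Friedmann energy `a'² - (8πG/3 ρ + c²Λ/3) a²` is conserved. -/
lemma IsFriedmannSolution.energy_eq (h : IsFriedmannSolution c G Λ P a ρ D) (hD : Convex ℝ D)
    {x y : ℝ} (hx : x ∈ D) (hy : y ∈ D) :
    deriv a x ^ 2 - (8 * π * G / 3 * ρ x + c ^ 2 * Λ / 3) * a x ^ 2 =
      deriv a y ^ 2 - (8 * π * G / 3 * ρ y + c ^ 2 * Λ / 3) * a y ^ 2 := by
  set E : ℝ → ℝ := fun t => deriv a t ^ 2 - (8 * π * G / 3 * ρ t + c ^ 2 * Λ / 3) * a t ^ 2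
  have hE : ∀ t ∈ D, HasDerivAt E 0 t := by
    intro t ht
    obtain ⟨ha, -, hda, hdda, hdρ⟩ := h t ht
    refine ((hdda.pow 2).sub (((hdρ.const_mul (8 * π * G / 3)).add_const (c ^ 2 * Λ / 3)).mul
      (hda.hasDerivAt.pow 2))).congr_deriv ?_
    simp only [Nat.cast_ofNat, Nat.add_one_sub_one, pow_one, Pi.pow_apply]
    field_simp
    ring
  have hcont : ContinuousOn E D := fun t ht => (hE t ht).continuousAt.continuousWithinAt
  have hmono : MonotoneOn E D := monotoneOn_of_hasDerivWithinAt_nonneg hD hcont (f' := fun _ => 0)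
    (fun t ht => (hE t (interior_subset ht)).hasDerivWithinAt) (fun _ _ => le_rfl)
  have hanti : AntitoneOn E D := antitoneOn_of_hasDerivWithinAt_nonpos hD hcont (f' := fun _ => 0)
    (fun t ht => (hE t (interior_subset ht)).hasDerivWithinAt) (fun _ _ => le_rfl)
  change E x = E y
  rcases le_total x y with hxy | hxy
  · exact le_antisymm (hmono hx hy hxy) (hanti hx hy hxy)
  · exact le_antisymm (hanti hy hx hxy) (hmono hy hx hxy)

/-- A solution of nonpositive curvature which expands at one time expands at all times. -/
lemma IsFriedmannSolution.deriv_pos (h : IsFriedmannSolution c G Λ P a ρ D) (hD : Convex ℝ D)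
    (hG : 0 < G) (hΛ : 0 ≤ Λ) {x y : ℝ} (hx : x ∈ D) (hpos : 0 < deriv a x)
    (hK : (8 * π * G / 3 * ρ x + c ^ 2 * Λ / 3) * a x ^ 2 ≤ deriv a x ^ 2) (hy : y ∈ D) :
    0 < deriv a y := by
  by_contra! hle
  have hcont : ContinuousOn (deriv a) D :=
    fun t ht => (h t ht).2.2.2.1.continuousAt.continuousWithinAt
  obtain ⟨z, hz, hz0⟩ := hD.isPreconnected.intermediate_value hy hx hcont ⟨hle, hpos.le⟩
  obtain ⟨haz, hρz, -⟩ := h z hz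
  have hE := h.energy_eq hD hz hx
  have : 0 < (8 * π * G / 3 * ρ z + c ^ 2 * Λ / 3) * a z ^ 2 := by positivity
  rw [hz0] at hE
  nlinarith

lemma IsFriedmannSolution.monotoneOn_scale (h : IsFriedmannSolution c G Λ P a ρ D)
    (hD : Convex ℝ D) {m : ℝ} (hm : ∀ t ∈ D, m ≤ deriv a t) :
    MonotoneOn (fun t => a t - m * t) D := by
  have hd : ∀ t ∈ D, HasDerivAt (fun t => a t - m * t) (deriv a t - m) t := fun t ht =>
    ((h t ht).2.2.1.hasDerivAt.sub ((hasDerivAt_id t).const_mul m)).congr_deriv (by simp)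
  exact monotoneOn_of_hasDerivWithinAt_nonneg hD
    (fun t ht => (hd t ht).continuousAt.continuousWithinAt) (f' := fun t => deriv a t - m)
    (fun t ht => (hd t (interior_subset ht)).hasDerivWithinAt)
    (fun t ht => sub_nonneg.2 (hm t (interior_subset ht)))

lemma IsFriedmannSolution.hasDerivAt_mul_pow (h : IsFriedmannSolution c G Λ P a ρ D)
    (n : ℕ) {t : ℝ} (ht : t ∈ D) :
    HasDerivAt (fun t => ρ t * a t ^ n)
      (((n - 3) * ρ t - 3 * (P (ρ t) / c ^ 2)) * (deriv a t * a t ^ n / a t)) t := by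
  obtain ⟨ha, -, hda, -, hdρ⟩ := h t ht
  refine (hdρ.mul (hda.hasDerivAt.pow n)).congr_deriv ?_
  rcases n with _ | n
  · simp
    ring
  · simp only [Nat.add_sub_cancel, Pi.pow_apply]
    push_cast
    field_simp
    ring

lemma IsFriedmannSolution.antitoneOn_mul_pow (h : IsFriedmannSolution c G Λ P a ρ D)
    (hD : Convex ℝ D) (hP : A0 c P) (hpos : ∀ t ∈ D, 0 < deriv a t) {n : ℕ} (hn : n ≤ 3) :
    AntitoneOn (fun t => ρ t * a t ^ n) D := by
  refine antitoneOn_of_hasDerivWithinAt_nonpos hD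
    (fun t ht => (h.hasDerivAt_mul_pow n ht).continuousAt.continuousWithinAt)
    (fun t ht => (h.hasDerivAt_mul_pow n (interior_subset ht)).hasDerivWithinAt) fun t ht => ?_
  obtain ⟨ha, hρ, -⟩ := h t (interior_subset ht)
  have hd := hpos t (interior_subset ht)
  have hPn : 0 ≤ P (ρ t) / c ^ 2 := div_nonneg (hP.2.1 _ hρ) (sq_nonneg c)
  have hn' : (n : ℝ) ≤ 3 := by exact_mod_cast hn
  exact mul_nonpos_of_nonpos_of_nonneg (by nlinarith) (by positivity)

lemma IsFriedmannSolution.monotoneOn_mul_pow (h : IsFriedmannSolution c G Λ P a ρ D)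
    (hD : Convex ℝ D) (hc : 0 < c) (hP : A0 c P) (hpos : ∀ t ∈ D, 0 < deriv a t) {n : ℕ}
    (hn : 6 ≤ n) : MonotoneOn (fun t => ρ t * a t ^ n) D := by
  refine monotoneOn_of_hasDerivWithinAt_nonneg hD
    (fun t ht => (h.hasDerivAt_mul_pow n ht).continuousAt.continuousWithinAt)
    (fun t ht => (h.hasDerivAt_mul_pow n (interior_subset ht)).hasDerivWithinAt) fun t ht => ?_
  obtain ⟨ha, hρ, -⟩ := h t (interior_subset ht)
  have hd := hpos t (interior_subset ht)
  have hPn : P (ρ t) / c ^ 2 ≤ ρ t := by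
    rw [div_le_iff₀ (by positivity), mul_comm]
    exact hP.le_mul hρ
  have hn' : (6 : ℝ) ≤ n := by exact_mod_cast hn
  exact mul_nonneg (by nlinarith) (by positivity)

end Expanding

/-- Local existence for the Friedmann system, as a first order system in `(a, a', ρ)`. -/
lemma exists_local_friedmann {c : ℝ} (G Λ : ℝ) {P : ℝ → ℝ} (hP : A0 c P) (T : ℝ)
    {l v r : ℝ} (hl : 0 < l) (hr : 0 < r) :
    ∃ s < T, ∃ x w σ : ℝ → ℝ, x T = l ∧ w T = v ∧ σ T = r ∧ ∀ t ∈ Ioc s T,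
      0 < x t ∧ 0 < σ t ∧ HasDerivAt x (w t) t ∧
      HasDerivAt w ((-(4 * π * G / 3) * (σ t + 3 * P (σ t) / c ^ 2) + c ^ 2 * Λ / 3) * x t) t ∧
      HasDerivAt σ (-3 * (σ t + P (σ t) / c ^ 2) * (w t / x t)) t := by
  set F : ℝ × ℝ × ℝ → ℝ × ℝ × ℝ := fun p =>
    (p.2.1, (-(4 * π * G / 3) * (p.2.2 + 3 * P p.2.2 / c ^ 2) + c ^ 2 * Λ / 3) * p.1,
      -3 * (p.2.2 + P p.2.2 / c ^ 2) * (p.2.1 / p.1)) with hF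
  have hPr : ContDiffAt ℝ 1 P r :=
    (hP.1.contDiffAt (Ioi_mem_nhds hr)).of_le (by exact_mod_cast le_top)
  have h1 : ContDiffAt ℝ 1 (fun p : ℝ × ℝ × ℝ => p.1) (l, v, r) := contDiffAt_fst
  have h2 : ContDiffAt ℝ 1 (fun p : ℝ × ℝ × ℝ => p.2.1) (l, v, r) := by fun_prop
  have h3 : ContDiffAt ℝ 1 (fun p : ℝ × ℝ × ℝ => p.2.2) (l, v, r) := by fun_prop
  have h4 : ContDiffAt ℝ 1 (fun p : ℝ × ℝ × ℝ => P p.2.2) (l, v, r) :=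
    ContDiffAt.comp (l, v, r) (g := P) hPr h3
  have hFd : ContDiffAt ℝ 1 F (l, v, r) := by
    refine h2.prodMk (ContDiffAt.prodMk ?_ ?_)
    · exact ((contDiffAt_const.mul (h3.add ((contDiffAt_const.mul h4).div_const _))).add
        contDiffAt_const).mul h1
    · exact (contDiffAt_const.mul (h3.add (h4.div_const _))).mul (h2.div h1 hl.ne')
  obtain ⟨α, hα0, ε, hε, hα⟩ :=
    hFd.exists_forall_mem_closedBall_exists_eq_forall_mem_Ioo_hasDerivAt₀ T
  have hαT : ContinuousAt α T := (hα T ⟨by linarith, by linarith⟩).continuousAt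
  have hx : ∀ᶠ t in 𝓝 T, 0 < (α t).1 :=
    (continuousAt_fst.comp hαT).eventually (lt_mem_nhds (by simpa [hα0] using hl))
  have hσ : ∀ᶠ t in 𝓝 T, 0 < (α t).2.2 :=
    ((continuous_snd.comp continuous_snd).continuousAt.comp hαT).eventually
      (lt_mem_nhds (by simpa [hα0] using hr))
  obtain ⟨s, hs, hsT⟩ := exists_Ioc_subset_of_mem_nhds
    ((hx.and hσ).and (Ioo_mem_nhds (by linarith : T - ε < T) (by linarith : T < T + ε)))
    ⟨T - 1, by linarith⟩
  refine ⟨s, hs, fun t => (α t).1, fun t => (α t).2.1, fun t => (α t).2.2, by simp [hα0],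
    by simp [hα0], by simp [hα0], fun t ht => ?_⟩
  obtain ⟨⟨hxt, hσt⟩, htε⟩ := hsT ht
  have hd := hα t htε
  exact ⟨hxt, hσt, hd.fst, hd.snd.fst, hd.snd.snd⟩

/-- A maximal solution cannot converge, at a finite left end, to a point of the domain. -/
lemma IsMaximalSolution.not_tendsto {c G Λ : ℝ} {P a ρ : ℝ → ℝ} {T : ℝ} {tp : EReal}
    (hmax : IsMaximalSolution c G Λ P a ρ T tp) (hP : A0 c P) {l v r : ℝ} (hl : 0 < l)
    (hr : 0 < r) (hal : Tendsto a (𝓝[>] T) (𝓝 l)) (hav : Tendsto (deriv a) (𝓝[>] T) (𝓝 v)) :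
    ¬ Tendsto ρ (𝓝[>] T) (𝓝 r) := by
  intro hρr
  obtain ⟨hT0, htp, hsol, hext⟩ := hmax
  have hT0' : T < 0 := by exact_mod_cast hT0
  obtain ⟨u, hu0, hutp⟩ := EReal.lt_iff_exists_real_btwn.1 htp
  have hu0' : (0 : ℝ) < u := by exact_mod_cast hu0
  obtain ⟨s, hsT, x, w, σ, rfl, rfl, rfl, hloc⟩ := exists_local_friedmann G Λ hP T (v := v) hl hr
  have hsolu : IsFriedmannSolution c G Λ P a ρ (Ioo T u) := hsol.mono fun t ht =>
    ⟨by exact_mod_cast ht.1, lt_trans (by exact_mod_cast ht.2) hutp⟩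
  have hTu : T < u := hT0'.trans hu0'
  have hPlim : Tendsto (fun t => P (ρ t)) (𝓝[>] T) (𝓝 (P (σ T))) :=
    (hP.1.contDiffAt (Ioi_mem_nhds hr)).continuousAt.tendsto.comp hρr
  have hda : ∀ t ∈ Ioo s u, HasDerivAt (fun t => if t ≤ T then x t else a t)
      (if t ≤ T then w t else deriv a t) t := fun t ht =>
    hasDerivAt_ite_le (fun t ht => (hloc t ht).2.2.1)
      (fun t ht => (hsolu t ht).2.2.1.hasDerivAt) hal hav hTu ht
  have hdda : ∀ t ∈ Ioo s u, HasDerivAt (fun t => if t ≤ T then w t else deriv a t) _ t :=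
    fun t ht => hasDerivAt_ite_le (fun t ht => (hloc t ht).2.2.2.1)
      (fun t ht => (hsolu t ht).2.2.2.1) hav
      (((hρr.add ((hPlim.const_mul 3).div_const _)).const_mul _ |>.add_const _).mul hal) hTu ht
  have hdρ : ∀ t ∈ Ioo s u, HasDerivAt (fun t => if t ≤ T then σ t else ρ t) _ t :=
    fun t ht => hasDerivAt_ite_le (fun t ht => (hloc t ht).2.2.2.2)
      (fun t ht => (hsolu t ht).2.2.2.2) hρr
      (((hρr.add (hPlim.div_const _)).const_mul _).mul (hav.div hal hl.ne')) hTu ht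
  have hderiv : ∀ t ∈ Ioo s u, deriv (fun t => if t ≤ T then x t else a t) t =
      if t ≤ T then w t else deriv a t := fun t ht => (hda t ht).deriv
  have hnew := hext (fun t => if t ≤ T then x t else a t) (fun t => if t ≤ T then σ t else ρ t)
    s u (hsT.trans hT0') hu0' ?_ (if_neg (not_le.2 hT0'))
    (by rw [hderiv 0 ⟨hsT.trans hT0', hu0'⟩, if_neg (not_le.2 hT0')]) (if_neg (not_le.2 hT0'))
  · exact absurd (by exact_mod_cast hnew.1 : T ≤ s) (not_le.2 hsT)
  · intro t ht
    have h2 := (hdda t ht).congr_of_eventuallyEq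
      (f₁ := deriv fun t => if t ≤ T then x t else a t) (by
        filter_upwards [Ioo_mem_nhds ht.1 ht.2] with y hy using hderiv y hy)
    have h3 := hdρ t ht
    have h1 := (hda t ht).differentiableAt
    rw [hderiv t ht]
    refine ⟨?_, ?_, h1, h2.congr_deriv ?_, h3.congr_deriv ?_⟩ <;> beta_reduce
    · split_ifs with h
      exacts [(hloc t ⟨ht.1, h⟩).1, (hsolu t ⟨not_le.1 h, ht.2⟩).1]
    · split_ifs with h
      exacts [(hloc t ⟨ht.1, h⟩).2.1, (hsolu t ⟨not_le.1 h, ht.2⟩).2.1]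
    · split_ifs <;> rfl
    · split_ifs <;> rfl

/-- Corollary 1: if `ȧ₀ > 0` and `K ≤ 0`, i.e.
`(8πG/3 ρ₀ + c²Λ/3) a₀² ≤ ȧ₀²`, then `t₋` is finite and `a(t) → 0`,
`ρ(t) → +∞` as `t → t₋ + 0`. -/
theorem big_bang_of_nonpos_curvature
    (c G Λ : ℝ) (hc : 0 < c) (hG : 0 < G) (hΛ : 0 < Λ)
    (P : ℝ → ℝ) (hA0 : A0 c P)
    (a ρ : ℝ → ℝ) (tm tp : EReal)
    (hmax : IsMaximalSolution c G Λ P a ρ tm tp)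
    (a0 adot0 ρ0 : ℝ) (ha0 : a 0 = a0) (hadot0 : deriv a 0 = adot0) (hρ0 : ρ 0 = ρ0)
    (ha0pos : 0 < a0) (hρ0pos : 0 < ρ0) (hadot0pos : 0 < adot0)
    (hK : (8 * Real.pi * G / 3 * ρ0 + c ^ 2 * Λ / 3) * a0 ^ 2 ≤ adot0 ^ 2) :
    ∃ T : ℝ, tm = (T : EReal) ∧
      Filter.Tendsto a (nhdsWithin T (Set.Ioi T)) (nhds 0) ∧
      Filter.Tendsto ρ (nhdsWithin T (Set.Ioi T)) Filter.atTop := by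
  subst ha0 hadot0 hρ0
  have hmax' := hmax
  obtain ⟨htm, htp, hsol, -⟩ := hmax'
  set D : Set ℝ := {t : ℝ | tm < (t : EReal) ∧ t ≤ 0} with hDdef
  have hD : Convex ℝ D := by
    refine OrdConnected.convex ⟨fun x hx y hy z hz => ⟨hx.1.trans_le ?_, hz.2.trans hy.2⟩⟩
    exact_mod_cast hz.1
  have h0D : (0 : ℝ) ∈ D := ⟨by exact_mod_cast htm, le_rfl⟩
  have h : IsFriedmannSolution c G Λ P a ρ D := hsol.mono fun t ht =>
    ⟨ht.1, lt_of_le_of_lt (by exact_mod_cast ht.2) htp⟩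
  have hpos : ∀ t ∈ D, 0 < deriv a t := fun t ht => h.deriv_pos hD hG hΛ.le h0D hadot0pos hK ht
  have hρa : ∀ t ∈ D, ρ 0 * a 0 ^ 2 ≤ ρ t * a t ^ 2 := fun t ht =>
    h.antitoneOn_mul_pow hD hA0 hpos (by norm_num) ht h0D ht.2
  have hEn : ∀ t ∈ D, 8 * π * G / 3 * (ρ t * a t ^ 2) + c ^ 2 * Λ / 3 * a t ^ 2 ≤
      deriv a t ^ 2 := fun t ht => by
    have := h.energy_eq hD ht h0D
    nlinarith
  set m : ℝ := √(8 * π * G / 3 * (ρ 0 * a 0 ^ 2)) with hm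
  have hmpos : 0 < m := Real.sqrt_pos.2 (by positivity)
  have hderivm : ∀ t ∈ D, m ≤ deriv a t := fun t ht => by
    refine Real.sqrt_le_iff.2 ⟨(hpos t ht).le, le_trans ?_ (hEn t ht)⟩
    have h1 : 8 * π * G / 3 * (ρ 0 * a 0 ^ 2) ≤ 8 * π * G / 3 * (ρ t * a t ^ 2) :=
      mul_le_mul_of_nonneg_left (hρa t ht) (by positivity)
    have h2 : 0 ≤ c ^ 2 * Λ / 3 * a t ^ 2 := by positivity
    linarith
  have hlow : ((-(a 0 / m) : ℝ) : EReal) ≤ tm := by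
    by_contra! hlt
    have htD : -(a 0 / m) ∈ D := ⟨hlt, neg_nonpos.2 (by positivity)⟩
    have h1 := h.monotoneOn_scale hD hderivm htD h0D htD.2
    have h2 := (h _ htD).1
    have h3 : m * (a 0 / m) = a 0 := by field_simp
    simp only at h1
    nlinarith
  induction tm using EReal.rec with
  | bot => exact absurd hlow (by simp)
  | top => exact absurd htm (by simp)
  | coe T =>
  have hT0 : T < 0 := by exact_mod_cast htm
  have hIoo : Ioo T 0 ⊆ D := fun t ht => ⟨by exact_mod_cast ht.1, ht.2.le⟩
  have hne : (Ioo T 0).Nonempty := nonempty_Ioo.2 hT0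
  have hmonoa : MonotoneOn a D := by
    simpa using h.monotoneOn_scale hD (m := 0) fun t ht => (hpos t ht).le
  have hev : ∀ᶠ t in 𝓝[>] T, t ∈ D := mem_of_superset (Ioo_mem_nhdsGT hT0) hIoo
  have hal := (hmonoa.mono hIoo).tendsto_nhdsWithin_Ioo_right hne
    ⟨0, by rintro _ ⟨t, ht, rfl⟩; exact (h t (hIoo ht)).1.le⟩
  set l := sInf (a '' Ioo T 0) with hldef
  have hl0 : 0 ≤ l := ge_of_tendsto hal (hev.mono fun t ht => (h t ht).1.le)
  rcases hl0.eq_or_lt with hl | hl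
  · rw [← hl] at hal
    refine ⟨T, rfl, hal, ?_⟩
    have hinv : Tendsto (fun t => ρ 0 * a 0 ^ 2 * (a t ^ 2)⁻¹) (𝓝[>] T) atTop := by
      refine Tendsto.const_mul_atTop (by positivity) (Tendsto.inv_tendsto_nhdsGT_zero ?_)
      refine tendsto_nhdsWithin_iff.2 ⟨by simpa using hal.pow 2, hev.mono fun t ht => ?_⟩
      exact pow_pos (h t ht).1 2
    refine tendsto_atTop_mono' _ (hev.mono fun t ht => ?_) hinv
    rw [← div_eq_mul_inv, div_le_iff₀ (pow_pos (h t ht).1 2)]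
    exact hρa t ht
  · exfalso
    have hla : ∀ t ∈ Ioo T 0, l ≤ a t := fun t ht => csInf_le
      ⟨0, by rintro _ ⟨t, ht, rfl⟩; exact (h t (hIoo ht)).1.le⟩ (mem_image_of_mem a ht)
    have hantiρ : AntitoneOn ρ D := by
      simpa using h.antitoneOn_mul_pow hD hA0 hpos (n := 0) (by norm_num)
    have hρr := (hantiρ.mono hIoo).tendsto_nhdsWithin_Ioo_right hne (by
      refine ⟨ρ 0 * a 0 ^ 6 / l ^ 6, ?_⟩
      rintro _ ⟨t, ht, rfl⟩
      rw [le_div_iff₀ (by positivity)]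
      have h1 := h.monotoneOn_mul_pow hD hc hA0 hpos le_rfl (hIoo ht) h0D ht.2.le
      refine le_trans (mul_le_mul_of_nonneg_left ?_ (h t (hIoo ht)).2.1.le) h1
      exact pow_le_pow_left₀ hl0 (hla t ht) 6)
    have hr : 0 < sSup (ρ '' Ioo T 0) := hρ0pos.trans_le
      (ge_of_tendsto hρr (hev.mono fun t ht => hantiρ ht h0D ht.2))
    obtain ⟨v, hav⟩ : ∃ v, Tendsto (deriv a) (𝓝[>] T) (𝓝 v) := by
      refine ⟨_, Tendsto.congr' (hev.mono fun t ht => ?_) (Real.continuous_sqrt.continuousAt.tendsto.comp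
        ((((hρr.const_mul (8 * π * G / 3)).add_const (c ^ 2 * Λ / 3)).mul (hal.pow 2)).const_add
          (deriv a 0 ^ 2 - (8 * π * G / 3 * ρ 0 + c ^ 2 * Λ / 3) * a 0 ^ 2)))⟩
      rw [Function.comp_apply, ← h.energy_eq hD ht h0D, sub_add_cancel,
        Real.sqrt_sq (hpos t ht).le]
    exact hmax.not_tendsto hA0 hl hr hal hav hρr
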